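/- arXiv:2402.14860 — 3 statements merged into one kernel-verified Lean document; each statement's English description precedes it below -/
import Mathlib

section
/- Let f_i, f_j, f_k : D → R be three models whose accuracies satisfy 1 ≥ a_{f_i} > a_{f_j} > a_{f_k} ≥ 0, and suppose no two of the three models agree on an incorrect response, i.e. for any two distinct models f, f' among {f_i, f_j, f_k} and any d ∈ D, if f(d) = f'(d) then f(d) = g(d). If a_{f_k} < a_{f_i} + a_{f_j} − 1, then f_k is voted worse by both f_i and f_j as judges: |Agr(f_i, f_k)| < |Agr(f_i, f_j)| and |Agr(f_j, f_k)| < |Agr(f_j, f_i)|. -/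
/-- The set of prompts on which model `f` answers correctly w.r.t. ground truth `g`. -/
def correctSet {D R : Type*} [Fintype D] [DecidableEq R] (g f : D → R) : Finset D :=
  Finset.univ.filter fun d => f d = g d

/-- The accuracy of model `f`: fraction of prompts answered correctly. -/
def acc {D R : Type*} [Fintype D] [DecidableEq R] (g f : D → R) : ℚ :=
  (correctSet g f).card / Fintype.card D

/-- The agreement set of two models `f`, `f'`. -/
def agr {D R : Type*} [Fintype D] [DecidableEq R] (f f' : D → R) : Finset D :=
  Finset.univ.filter fun d => f d = f' d

theorem card_correctSet_add_card_le {D R : Type*} [Fintype D] [DecidableEq R] (g f f' : D → R) :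
    (correctSet g f).card + (correctSet g f').card ≤ Fintype.card D + (agr f f').card := by
  classical
  rw [← Finset.card_union_add_card_inter]
  refine add_le_add (Finset.card_le_univ _) (Finset.card_le_card fun d hd => ?_)
  simp only [correctSet, agr, Finset.mem_inter, Finset.mem_filter, Finset.mem_univ,
    true_and] at hd ⊢
  exact hd.1.trans hd.2.symm

theorem card_agr_le_card_correctSet {D R : Type*} [Fintype D] [DecidableEq R] {g f f' : D → R}
    (h : ∀ d, f d = f' d → f d = g d) : (agr f f').card ≤ (correctSet g f').card := by
  refine Finset.card_le_card fun d hd => ?_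
  simp only [correctSet, agr, Finset.mem_filter, Finset.mem_univ, true_and] at hd ⊢
  exact hd.symm.trans (h d hd)

theorem card_lt_of_acc_lt {D R : Type*} [Fintype D] [Nonempty D] [DecidableEq R]
    {g f f' f'' : D → R} (h : acc g f'' < acc g f + acc g f' - 1) :
    (correctSet g f'').card + Fintype.card D <
      (correctSet g f).card + (correctSet g f').card := by
  have hD : (0 : ℚ) < Fintype.card D := by exact_mod_cast Fintype.card_pos
  have h' := lt_sub_iff_add_lt.mp h
  rw [acc, acc, acc, ← add_div, div_add_one hD.ne', div_lt_div_iff_of_pos_right hD] at h'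
  exact_mod_cast h'

/-- Lemma 1: if no two of the three models agree on an incorrect response and
`a_k < a_i + a_j − 1`, then `f_k` is voted worse by both `f_i` and `f_j` as judges. -/
theorem triplet_no_incorrect_agreement
    {D R : Type*} [Fintype D] [Nonempty D] [DecidableEq R]
    (g f_i f_j f_k : D → R)
    (h1 : 1 ≥ acc g f_i) (h2 : acc g f_i > acc g f_j) (h3 : acc g f_j > acc g f_k)
    (h4 : acc g f_k ≥ 0)
    (hdis : ∀ f f' : D → R, f ∈ ({f_i, f_j, f_k} : Set (D → R)) →
      f' ∈ ({f_i, f_j, f_k} : Set (D → R)) → f ≠ f' → ∀ d : D, f d = f' d → f d = g d)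
    (hcond : acc g f_k < acc g f_i + acc g f_j - 1) :
    (agr f_i f_k).card < (agr f_i f_j).card ∧
      (agr f_j f_k).card < (agr f_j f_i).card := by
  have hik : f_i ≠ f_k := by
    rintro rfl
    exact lt_asymm h2 h3
  have hjk : f_j ≠ f_k := by
    rintro rfl
    exact lt_irrefl _ h3
  have hcard := card_lt_of_acc_lt hcond
  have hij_le := card_correctSet_add_card_le g f_i f_j
  have hji_le := card_correctSet_add_card_le g f_j f_i
  have hik_le := card_agr_le_card_correctSet (hdis f_i f_k (by simp) (by simp) hik)
  have hjk_le := card_agr_le_card_correctSet (hdis f_j f_k (by simp) (by simp) hjk)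
  omega
end

section
/- Let f_i, f_j, f_k : D → R be models with correct sets A_i, A_j, A_k, and let M be a natural number such that f_j and f_k agree on at most M incorrect responses, i.e. |{d ∈ D : f_j(d) = f_k(d) ∧ f_k(d) ≠ g(d)}| ≤ M. If |A_k| + M + |D| < |A_i| + |A_j|, then judge f_j votes f_k worse than f_i: |Agr(f_j, f_k)| < |Agr(f_j, f_i)|. -/
theorem card_agr_le_card_correctSet_add {D R : Type*} [Fintype D] [DecidableEq R]
    (g f f' : D → R) :
    (agr f f').card ≤ (correctSet g f').card +
      (Finset.univ.filter fun d => f d = f' d ∧ f' d ≠ g d).card := by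
  classical
  refine (Finset.card_le_card fun d hd => ?_).trans (Finset.card_union_le _ _)
  simp only [agr, correctSet, Finset.mem_union, Finset.mem_filter, Finset.mem_univ,
    true_and] at hd ⊢
  tauto

theorem card_correctSet_add_le_card_agr_add {D R : Type*} [Fintype D] [DecidableEq R]
    (g f f' : D → R) :
    (correctSet g f').card + (correctSet g f).card ≤ (agr f f').card + Fintype.card D := by
  classical
  have inter_subset : correctSet g f' ∩ correctSet g f ⊆ agr f f' := by
    intro d hd
    simp only [agr, correctSet, Finset.mem_inter, Finset.mem_filter, Finset.mem_univ,
      true_and] at hd ⊢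
    exact hd.2.trans hd.1.symm
  rw [← Finset.card_inter_add_card_union]
  exact add_le_add (Finset.card_le_card inter_subset) (Finset.card_le_univ _)

/-- If `f_j` and `f_k` agree on at most `M` incorrect responses and
`|A_k| + M + |D| < |A_i| + |A_j|`, then judge `f_j` votes `f_k` worse than `f_i`. -/
theorem judge_j_votes_k_worse
    {D R : Type*} [Fintype D] [Nonempty D] [DecidableEq R]
    (g f_i f_j f_k : D → R) (M : ℕ)
    (hM : (Finset.univ.filter fun d => f_j d = f_k d ∧ f_k d ≠ g d).card ≤ M)
    (h : (correctSet g f_k).card + M + Fintype.card D <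
      (correctSet g f_i).card + (correctSet g f_j).card) :
    (agr f_j f_k).card < (agr f_j f_i).card := by
  have upper := card_agr_le_card_correctSet_add g f_j f_k
  have lower := card_correctSet_add_le_card_agr_add g f_j f_i
  omega
end

section
/- Let α be a linearly ordered type and S a finite subset of α with |S| ≥ 3. Define the Greedy Triplet Ranking output as follows: extract from S the set P₁ of its two largest elements (via the greedy triplet pass, which correctly identifies them); list the two elements of P₁ first, in either order; then repeatedly, while at least 3 elements remain, extract the two largest remaining elements and append them in descending order; if exactly two elements remain append them in descending order, and if one remains append it. Then every list producible by this procedure is equal to the strictly descending sort of S, except that its first two entries may be transposed. -/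
/-- The set of the two largest elements of `S`: those elements exceeded by at most
one element of `S`. -/
def topTwo {α : Type*} [LinearOrder α] (S : Finset α) : Finset α :=
  S.filter fun x => (S.filter fun y => x < y).card ≤ 1

/-- The strictly descending sort of a finite set. -/
def descSort {α : Type*} [LinearOrder α] (S : Finset α) : List α :=
  (S.sort (· ≤ ·)).reverse

/-- The deterministic tail of the Greedy Triplet Ranking: while at least 3 elements
remain, extract the two largest and append them in descending order; when at most
two remain, append them in descending order. -/
def gtrRest {α : Type*} [LinearOrder α] (S : Finset α) : List α :=
  if h : 3 ≤ S.card then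
    descSort (topTwo S) ++ gtrRest (S \ topTwo S)
  else
    descSort S
termination_by S.card
decreasing_by
  have hS : S.Nonempty := Finset.card_pos.mp (by omega)
  have hmem : S.max' hS ∈ topTwo S := by
    refine Finset.mem_filter.mpr ⟨S.max'_mem hS, ?_⟩
    have hempty : S.filter (fun y => S.max' hS < y) = ∅ :=
      Finset.filter_eq_empty_iff.mpr fun y hy => not_lt.mpr (S.le_max' y hy)
    rw [hempty]
    simp
  exact Finset.card_lt_card
    (Finset.sdiff_ssubset (Finset.filter_subset _ _) ⟨_, hmem⟩)

/-- The lists producible by the Greedy Triplet Ranking procedure on `S`: the two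
largest elements of `S` are listed first in either order, followed by the
deterministic remainder of the procedure. -/
def gtrOutputs {α : Type*} [LinearOrder α] (S : Finset α) : Set (List α) :=
  {L | ∃ a b : α, a ≠ b ∧ topTwo S = {a, b} ∧ L = a :: b :: gtrRest (S \ topTwo S)}

theorem mem_descSort {α : Type*} [LinearOrder α] {S : Finset α} {x : α} :
    x ∈ descSort S ↔ x ∈ S := by
  simp [descSort]

theorem pairwise_descSort {α : Type*} [LinearOrder α] (S : Finset α) :
    (descSort S).Pairwise (· > ·) := by
  rw [descSort, List.pairwise_reverse]
  exact S.sortedLT_sort.pairwise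

theorem eq_descSort {α : Type*} [LinearOrder α] {S : Finset α} {L : List α}
    (hL : L.Pairwise (· > ·)) (hmem : ∀ x, x ∈ L ↔ x ∈ S) : L = descSort S :=
  hL.eq_of_mem_iff (pairwise_descSort S) fun x => (hmem x).trans mem_descSort.symm

theorem lt_of_mem_topTwo {α : Type*} [LinearOrder α] {S : Finset α} {x y : α}
    (hx : x ∈ topTwo S) (hy : y ∈ S \ topTwo S) : y < x := by
  simp only [topTwo, Finset.mem_sdiff, Finset.mem_filter, not_and, not_le] at hx hy
  by_contra! h
  have hsub : S.filter (fun z => y < z) ⊆ S.filter (fun z => x < z) :=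
    Finset.monotone_filter_right S fun z _ hz => h.trans_lt hz
  exact absurd (Finset.card_le_card hsub) (by have := hy.2 hy.1; omega)

theorem topTwo_subset {α : Type*} [LinearOrder α] (S : Finset α) : topTwo S ⊆ S :=
  Finset.filter_subset _ _

theorem descSort_topTwo_append {α : Type*} [LinearOrder α] (S : Finset α) :
    descSort (topTwo S) ++ descSort (S \ topTwo S) = descSort S := by
  refine eq_descSort ?_ fun x => ?_
  · refine List.pairwise_append.mpr ⟨pairwise_descSort _, pairwise_descSort _, ?_⟩
    intro x hx y hy
    exact lt_of_mem_topTwo (mem_descSort.mp hx) (mem_descSort.mp hy)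
  · rw [List.mem_append, mem_descSort, mem_descSort, ← Finset.mem_union,
      Finset.union_sdiff_of_subset (topTwo_subset S)]

theorem gtrRest_eq_descSort {α : Type*} [LinearOrder α] (S : Finset α) :
    gtrRest S = descSort S := by
  induction S using gtrRest.induct with
  | case1 S h ih => rw [gtrRest, dif_pos h, ih, descSort_topTwo_append]
  | case2 S h => rw [gtrRest, dif_neg h]

theorem descSort_pair {α : Type*} [LinearOrder α] {a b : α} (h : b < a) :
    descSort {a, b} = [a, b] :=
  (eq_descSort (by simpa using h) (by simp)).symm

/-- Every list producible by the Greedy Triplet Ranking procedure on a finite set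
`S` with `|S| ≥ 3` equals the strictly descending sort of `S`, except that its
first two entries may be transposed. -/
theorem gtr_output_eq_descSort_up_to_top_transposition
    {α : Type*} [LinearOrder α] (S : Finset α) (hS : 3 ≤ S.card)
    (L : List α) (hL : L ∈ gtrOutputs S) :
    ∃ (x y : α) (rest : List α), descSort S = x :: y :: rest ∧
      (L = x :: y :: rest ∨ L = y :: x :: rest) := by
  obtain ⟨a, b, hab, htop, rfl⟩ := hL
  rw [gtrRest_eq_descSort, ← descSort_topTwo_append S]
  rcases hab.lt_or_gt with h | h
  · refine ⟨b, a, descSort (S \ topTwo S), ?_, Or.inr rfl⟩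
    rw [htop, Finset.pair_comm, descSort_pair h]
    rfl
  · refine ⟨a, b, descSort (S \ topTwo S), ?_, Or.inl rfl⟩
    rw [htop, descSort_pair h]
    rfl
end
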